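/- arXiv:2002.07430 — 7 statements merged into one kernel-verified Lean document; each statement's English description precedes it below -/
import Mathlib

section
/- Let μ, ν be real with −3/2 < ν < μ. Then the function x ↦ x^{μ−ν} L_ν(x)/t̃_{μ,ν}(x) is strictly increasing on (0,∞). If instead either (−3 < μ ≤ −3/2 and |ν| < μ+3) or (μ > −3/2 and μ < ν < μ+3), then x ↦ x^{μ−ν} L_ν(x)/t̃_{μ,ν}(x) is strictly decreasing on (0,∞). -/
open Real

/-- Normalized modified Lommel function of the first kind. -/
noncomputable def modLommel (μ ν x : ℝ) : ℝ :=
  ∑' k : ℕ, (x / 2) ^ (μ + 2 * (k : ℝ) + 1) /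
    (Gamma ((k : ℝ) + (μ - ν + 3) / 2) * Gamma ((k : ℝ) + (μ + ν + 3) / 2))

/-- Modified Struve function of the first kind. -/
noncomputable def modStruve (ν x : ℝ) : ℝ :=
  ∑' k : ℕ, (x / 2) ^ (2 * (k : ℝ) + ν + 1) /
    (Gamma ((k : ℝ) + 3 / 2) * Gamma ((k : ℝ) + ν + 3 / 2))

/-- If the ratio of coefficients `a k / b k` is strictly increasing, then so is the ratio of the
power series `∑ a k * y ^ k` and `∑ b k * y ^ k`, here in cross-multiplied form. -/
theorem tsum_mul_tsum_lt_of_strictMono_div {a b : ℕ → ℝ} (ha : ∀ k, 0 < a k)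
    (hb : ∀ k, 0 < b k) (hmono : StrictMono fun k => a k / b k)
    (hsa : ∀ y : ℝ, 0 < y → Summable fun k => a k * y ^ k)
    (hsb : ∀ y : ℝ, 0 < y → Summable fun k => b k * y ^ k)
    {y z : ℝ} (hy : 0 < y) (hyz : y < z) :
    (∑' k, a k * y ^ k) * (∑' k, b k * z ^ k) < (∑' k, a k * z ^ k) * (∑' k, b k * y ^ k) := by
  have hz : 0 < z := hy.trans hyz
  have summable_prod : ∀ s t : ℝ, 0 < s → 0 < t →
      Summable fun i : ℕ × ℕ => (a i.1 * s ^ i.1) * (b i.2 * t ^ i.2) := fun s t hs ht =>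
    (hsa s hs).mul_of_nonneg (hsb t ht)
      (fun k => by have := ha k; positivity) (fun k => by have := hb k; positivity)
  have h₁ := summable_prod z y hz hy
  have h₂ := summable_prod y z hy hz
  rw [(hsa y hy).tsum_mul_tsum (hsb z hz) h₂, (hsa z hz).tsum_mul_tsum (hsb y hy) h₁, ← sub_pos,
    ← h₁.tsum_sub h₂]
  set f : ℕ × ℕ → ℝ := fun i =>
    (a i.1 * z ^ i.1) * (b i.2 * y ^ i.2) - (a i.1 * y ^ i.1) * (b i.2 * z ^ i.2) with hf
  have hsf : Summable f := h₁.sub h₂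
  have hsf' : Summable fun i : ℕ × ℕ => f i.swap := (Equiv.prodComm ℕ ℕ).summable_iff.mpr hsf
  have hswap : ∑' i : ℕ × ℕ, f i.swap = ∑' i, f i := (Equiv.prodComm ℕ ℕ).tsum_eq f
  have hsymm : ∀ j k, f (j, k) + f (k, j) =
      (a j * b k - a k * b j) * (z ^ j * y ^ k - y ^ j * z ^ k) := fun j k => by
    simp only [hf]; ring
  have hpos : ∀ j k, k < j → 0 < f (j, k) + f (k, j) := fun j k hjk => by
    rw [hsymm]
    refine mul_pos ?_ ?_
    · have := hmono hjk
      rw [div_lt_div_iff₀ (hb k) (hb j)] at this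
      linarith
    · obtain ⟨d, rfl⟩ := Nat.exists_eq_add_of_lt hjk
      have hd : y ^ (d + 1) < z ^ (d + 1) := pow_lt_pow_left₀ hyz hy.le (by omega)
      have hfactor : z ^ (k + d + 1) * y ^ k - y ^ (k + d + 1) * z ^ k =
          (y ^ k * z ^ k) * (z ^ (d + 1) - y ^ (d + 1)) := by ring
      rw [hfactor]
      exact mul_pos (by positivity) (sub_pos.mpr hd)
  have hnonneg : ∀ i : ℕ × ℕ, 0 ≤ f i + f i.swap := by
    rintro ⟨j, k⟩
    rcases lt_trichotomy k j with h | rfl | h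
    · exact (hpos j k h).le
    · exact (hsymm k k).ge.trans' (by simp)
    · rw [add_comm]; exact (hpos k j h).le
  have htwo : 0 < ∑' i : ℕ × ℕ, (f i + f i.swap) :=
    (hsf.add hsf').tsum_pos hnonneg (1, 0) (hpos 1 0 one_pos)
  rw [hsf.tsum_add hsf', hswap] at htwo
  linarith

/-- The coefficient `1 / (Γ(k + p) Γ(k + q))`. -/
noncomputable def gammaCoeff (p q : ℝ) (k : ℕ) : ℝ :=
  1 / (Gamma ((k : ℝ) + p) * Gamma ((k : ℝ) + q))

theorem gammaCoeff_pos {p q : ℝ} (hp : 0 < p) (hq : 0 < q) (k : ℕ) : 0 < gammaCoeff p q k :=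
  one_div_pos.mpr (mul_pos (Gamma_pos_of_pos (by positivity)) (Gamma_pos_of_pos (by positivity)))

theorem gammaCoeff_succ {p q : ℝ} (hp : 0 < p) (hq : 0 < q) (k : ℕ) :
    gammaCoeff p q (k + 1) = gammaCoeff p q k / (((k : ℝ) + p) * ((k : ℝ) + q)) := by
  have hp' : (k : ℝ) + p ≠ 0 := by positivity
  have hq' : (k : ℝ) + q ≠ 0 := by positivity
  have h₁ : Gamma (((k + 1 : ℕ) : ℝ) + p) = ((k : ℝ) + p) * Gamma ((k : ℝ) + p) := by
    rw [← Gamma_add_one hp']; push_cast; ring_nf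
  have h₂ : Gamma (((k + 1 : ℕ) : ℝ) + q) = ((k : ℝ) + q) * Gamma ((k : ℝ) + q) := by
    rw [← Gamma_add_one hq']; push_cast; ring_nf
  rw [gammaCoeff, gammaCoeff, h₁, h₂, div_div]
  ring_nf

theorem summable_gammaCoeff_mul_pow {p q : ℝ} (hp : 0 < p) (hq : 0 < q) {y : ℝ} (hy : 0 < y) :
    Summable fun k => gammaCoeff p q k * y ^ k := by
  have hpos : ∀ k, 0 < gammaCoeff p q k * y ^ k := fun k =>
    mul_pos (gammaCoeff_pos hp hq k) (pow_pos hy k)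
  refine summable_of_ratio_test_tendsto_lt_one zero_lt_one
    (Filter.Eventually.of_forall fun k => (hpos k).ne') ?_
  have hlin : ∀ r : ℝ, Filter.Tendsto (fun k : ℕ => (k : ℝ) + r) Filter.atTop Filter.atTop :=
    fun r => Filter.tendsto_atTop_add_const_right _ r tendsto_natCast_atTop_atTop
  refine (((hlin p).atTop_mul_atTop₀ (hlin q)).const_div_atTop y).congr fun k => ?_
  have hc := (gammaCoeff_pos hp hq k).ne'
  have hp' : (k : ℝ) + p ≠ 0 := by positivity
  have hq' : (k : ℝ) + q ≠ 0 := by positivity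
  rw [Real.norm_of_nonneg (hpos _).le, Real.norm_of_nonneg (hpos _).le, gammaCoeff_succ hp hq,
    pow_succ]
  field_simp

/-- The power series with coefficients `gammaCoeff p q`. -/
noncomputable def gammaSeries (p q y : ℝ) : ℝ := ∑' k, gammaCoeff p q k * y ^ k

theorem gammaSeries_pos {p q : ℝ} (hp : 0 < p) (hq : 0 < q) {y : ℝ} (hy : 0 < y) :
    0 < gammaSeries p q y :=
  (summable_gammaCoeff_mul_pow hp hq hy).tsum_pos
    (fun k => (mul_pos (gammaCoeff_pos hp hq k) (pow_pos hy k)).le) 0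
    (mul_pos (gammaCoeff_pos hp hq 0) (pow_pos hy 0))

theorem gammaSeries_mul_lt {p q r s : ℝ} (hp : 0 < p) (hq : 0 < q) (hr : 0 < r) (hs : 0 < s)
    (h : ∀ k : ℕ, ((k : ℝ) + p) * ((k : ℝ) + q) < ((k : ℝ) + r) * ((k : ℝ) + s))
    {y z : ℝ} (hy : 0 < y) (hyz : y < z) :
    gammaSeries p q y * gammaSeries r s z < gammaSeries p q z * gammaSeries r s y := by
  refine tsum_mul_tsum_lt_of_strictMono_div (gammaCoeff_pos hp hq) (gammaCoeff_pos hr hs)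
    (strictMono_nat_of_lt_succ fun k => ?_)
    (fun _ => summable_gammaCoeff_mul_pow hp hq) (fun _ => summable_gammaCoeff_mul_pow hr hs)
    hy hyz
  have ha := gammaCoeff_pos hp hq k
  have hb := gammaCoeff_pos hr hs k
  have hpq : 0 < ((k : ℝ) + p) * ((k : ℝ) + q) := by positivity
  rw [gammaCoeff_succ hp hq, gammaCoeff_succ hr hs, div_div_div_eq,
    div_lt_div_iff₀ hb (mul_pos hpq hb)]
  nlinarith [mul_lt_mul_of_pos_left (h k) (mul_pos ha hb)]

theorem half_rpow_add_two_mul {x : ℝ} (hx : 0 < x) (c : ℝ) (k : ℕ) :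
    (x / 2) ^ (c + 2 * (k : ℝ)) = (x / 2) ^ c * ((x / 2) ^ 2) ^ k := by
  rw [rpow_add (by positivity), ← pow_mul, ← rpow_natCast (x / 2) (2 * k)]
  push_cast
  rfl

theorem modLommel_eq_gammaSeries (μ ν : ℝ) {x : ℝ} (hx : 0 < x) :
    modLommel μ ν x = (x / 2) ^ (μ + 1) *
      gammaSeries ((μ - ν + 3) / 2) ((μ + ν + 3) / 2) ((x / 2) ^ 2) := by
  rw [modLommel, gammaSeries, ← tsum_mul_left]
  refine tsum_congr fun k => ?_
  rw [show μ + 2 * (k : ℝ) + 1 = μ + 1 + 2 * (k : ℝ) by ring, half_rpow_add_two_mul hx, gammaCoeff]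
  ring

theorem modStruve_eq_gammaSeries (ν : ℝ) {x : ℝ} (hx : 0 < x) :
    modStruve ν x = (x / 2) ^ (ν + 1) * gammaSeries (3 / 2) (ν + 3 / 2) ((x / 2) ^ 2) := by
  rw [modStruve, gammaSeries, ← tsum_mul_left]
  refine tsum_congr fun k => ?_
  rw [show 2 * (k : ℝ) + ν + 1 = ν + 1 + 2 * (k : ℝ) by ring, half_rpow_add_two_mul hx, gammaCoeff,
    add_assoc (k : ℝ) ν]
  ring

theorem rpow_mul_modStruve_div_modLommel (μ ν : ℝ) {x : ℝ} (hx : 0 < x) :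
    x ^ (μ - ν) * modStruve ν x / modLommel μ ν x =
      2 ^ (μ - ν) * (gammaSeries (3 / 2) (ν + 3 / 2) ((x / 2) ^ 2) /
        gammaSeries ((μ - ν + 3) / 2) ((μ + ν + 3) / 2) ((x / 2) ^ 2)) := by
  have hx2 : 0 < x / 2 := by positivity
  have hpow : x ^ (μ - ν) * (x / 2) ^ (ν + 1) = 2 ^ (μ - ν) * (x / 2) ^ (μ + 1) := by
    rw [show μ + 1 = (μ - ν) + (ν + 1) by ring, rpow_add hx2 (μ - ν) (ν + 1), ← mul_assoc,
      ← mul_rpow zero_le_two hx2.le, mul_div_cancel₀ x two_ne_zero]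
  rw [modLommel_eq_gammaSeries μ ν hx, modStruve_eq_gammaSeries ν hx, ← mul_assoc, hpow,
    mul_comm (2 ^ (μ - ν)), mul_assoc, mul_div_mul_left _ _ (rpow_pos_of_pos hx2 _).ne',
    mul_div_assoc]

theorem stmt_0 (μ ν : ℝ) :
    (-3/2 < ν → ν < μ →
      StrictMonoOn (fun x : ℝ => x ^ (μ - ν) * modStruve ν x / modLommel μ ν x)
        (Set.Ioi (0 : ℝ))) ∧
    (((-3 < μ ∧ μ ≤ -3/2 ∧ |ν| < μ + 3) ∨ (-3/2 < μ ∧ μ < ν ∧ ν < μ + 3)) →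
      StrictAntiOn (fun x : ℝ => x ^ (μ - ν) * modStruve ν x / modLommel μ ν x)
        (Set.Ioi (0 : ℝ))) := by
  have hid : ∀ k : ℕ, ((k : ℝ) + (μ - ν + 3) / 2) * ((k : ℝ) + (μ + ν + 3) / 2) -
      ((k : ℝ) + 3 / 2) * ((k : ℝ) + (ν + 3 / 2)) =
      (μ - ν) * ((k : ℝ) + (μ + ν + 6) / 4) := fun k => by ring
  have hsq : ∀ {x y : ℝ}, 0 < x → x < y → (x / 2) ^ 2 < (y / 2) ^ 2 := fun hx hxy =>
    pow_lt_pow_left₀ (by linarith) (by positivity) two_ne_zero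
  refine ⟨fun hν hμ x hx y hy hxy => ?_, fun h x hx y hy hxy => ?_⟩
  · have hp : 0 < (μ - ν + 3) / 2 := by linarith
    have hq : 0 < (μ + ν + 3) / 2 := by linarith
    have hs : 0 < ν + 3 / 2 := by linarith
    rw [Set.mem_Ioi] at hx hy
    simp only [rpow_mul_modStruve_div_modLommel μ ν hx, rpow_mul_modStruve_div_modLommel μ ν hy]
    refine mul_lt_mul_of_pos_left ?_ (by positivity)
    rw [div_lt_div_iff₀ (gammaSeries_pos hp hq (by positivity))
      (gammaSeries_pos hp hq (by positivity))]
    refine gammaSeries_mul_lt (by norm_num) hs hp hq (fun k => ?_) (by positivity) (hsq hx hxy)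
    rw [← sub_pos, hid]
    exact mul_pos (by linarith) (add_pos_of_nonneg_of_pos k.cast_nonneg (by linarith))
  · obtain ⟨hμν, hp, hq, hs⟩ :
        μ < ν ∧ 0 < (μ - ν + 3) / 2 ∧ 0 < (μ + ν + 3) / 2 ∧ 0 < ν + 3 / 2 := by
      rcases h with ⟨h₁, h₂, h₃⟩ | ⟨h₁, h₂, h₃⟩
      · rw [abs_lt] at h₃
        refine ⟨?_, ?_, ?_, ?_⟩ <;> linarith
      · refine ⟨?_, ?_, ?_, ?_⟩ <;> linarith
    rw [Set.mem_Ioi] at hx hy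
    simp only [rpow_mul_modStruve_div_modLommel μ ν hx, rpow_mul_modStruve_div_modLommel μ ν hy]
    refine mul_lt_mul_of_pos_left ?_ (by positivity)
    rw [div_lt_div_iff₀ (gammaSeries_pos hp hq (by positivity))
      (gammaSeries_pos hp hq (by positivity)), mul_comm, mul_comm (gammaSeries (3 / 2) _ _)]
    refine gammaSeries_mul_lt hp hq (by norm_num) hs (fun k => ?_) (by positivity) (hsq hx hxy)
    rw [← sub_neg, hid]
    exact mul_neg_of_neg_of_pos (by linarith)
      (add_pos_of_nonneg_of_pos k.cast_nonneg (by linarith))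
end

section
/- Let μ, ν be real with μ > −2 and |ν| < |μ+1|. Then the function x ↦ I_{μ+1}(x)/t̃_{μ,ν}(x) is strictly increasing on (0,∞). If instead μ > −2 and |μ+1| < |ν| < μ+3, then x ↦ I_{μ+1}(x)/t̃_{μ,ν}(x) is strictly decreasing on (0,∞). -/
open Real

/-- Modified Bessel function of the first kind. -/
noncomputable def modBessel (ν x : ℝ) : ℝ :=
  ∑' k : ℕ, (x / 2) ^ (2 * (k : ℝ) + ν) /
    ((Nat.factorial k : ℝ) * Gamma ((k : ℝ) + ν + 1))

open Filter Topology in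
/-- The power series with coefficients `1 / (Γ(k + p) Γ(k + q))` converges for positive argument. -/
theorem summable_pow_div_gamma_mul_gamma {p q y : ℝ} (hp : 0 < p) (hq : 0 < q) (hy : 0 < y) :
    Summable fun k : ℕ => 1 / (Gamma (k + p) * Gamma (k + q)) * y ^ k := by
  have hpos (k : ℕ) : 0 < 1 / (Gamma (k + p) * Gamma (k + q)) * y ^ k := by
    have := Gamma_pos_of_pos (show (0 : ℝ) < k + p by positivity)
    have := Gamma_pos_of_pos (show (0 : ℝ) < k + q by positivity)
    positivity
  refine summable_of_ratio_test_tendsto_lt_one zero_lt_one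
    (.of_forall fun k => (hpos k).ne') ?_
  have hlim : Tendsto (fun k : ℕ => y / (((k : ℝ) + p) * (k + q))) atTop (𝓝 0) :=
    tendsto_const_nhds.div_atTop
      ((tendsto_natCast_atTop_atTop.atTop_add tendsto_const_nhds).atTop_mul_atTop₀
        (tendsto_natCast_atTop_atTop.atTop_add tendsto_const_nhds))
  refine hlim.congr fun k => ?_
  rw [Real.norm_of_nonneg (hpos _).le, Real.norm_of_nonneg (hpos _).le]
  have hkp : (0 : ℝ) < k + p := by positivity
  have hkq : (0 : ℝ) < k + q := by positivity
  have := (Gamma_pos_of_pos hkp).ne'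
  have := (Gamma_pos_of_pos hkq).ne'
  rw [show ((k + 1 : ℕ) : ℝ) + p = (k + p) + 1 by push_cast; ring,
    show ((k + 1 : ℕ) : ℝ) + q = (k + q) + 1 by push_cast; ring,
    Gamma_add_one hkp.ne', Gamma_add_one hkq.ne']
  field_simp
  rw [pow_succ']

/-- A quotient of two power series is strictly increasing on the positive axis if the denominator
has positive coefficients and the quotients of coefficients strictly increase. -/
theorem strictMonoOn_tsum_div_tsum {r b : ℕ → ℝ} (hr : StrictMono r) (hb : ∀ k, 0 < b k)
    (hsb : ∀ y : ℝ, 0 < y → Summable fun k => b k * y ^ k)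
    (hsa : ∀ y : ℝ, 0 < y → Summable fun k => r k * b k * y ^ k) :
    StrictMonoOn (fun y : ℝ => (∑' k, r k * b k * y ^ k) / ∑' k, b k * y ^ k) (Set.Ioi 0) := by
  intro y hy z hz hyz
  rw [Set.mem_Ioi] at hy hz
  have hB (w : ℝ) (hw : 0 < w) : 0 < ∑' k, b k * w ^ k :=
    (hsb w hw).tsum_pos (fun k => (mul_pos (hb k) (pow_pos hw k)).le) 0
      (mul_pos (hb 0) (pow_pos hw 0))
  set c := (∑' k, r k * b k * y ^ k) / ∑' k, b k * y ^ k with hc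
  have hdiff (w : ℝ) (hw : 0 < w) : HasSum (fun k => (r k - c) * (b k * w ^ k))
      ((∑' k, r k * b k * w ^ k) - c * ∑' k, b k * w ^ k) :=
    ((hsa w hw).hasSum.sub ((hsb w hw).hasSum.mul_left c)).congr_fun fun k => by ring
  have hzero : (∑' k, r k * b k * y ^ k) - c * ∑' k, b k * y ^ k = 0 := by
    rw [hc, div_mul_cancel₀ _ (hB y hy).ne', sub_self]
  have hy0 := hdiff y hy
  rw [hzero] at hy0
  have hex : ∃ n, c ≤ r n := by
    by_contra! h
    have hneg (k : ℕ) : (r k - c) * (b k * y ^ k) < 0 :=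
      mul_neg_of_neg_of_pos (sub_neg.2 (h k)) (mul_pos (hb k) (pow_pos hy k))
    exact (hasSum_lt (fun k => (hneg k).le) (hneg 0) hy0 hasSum_zero).ne rfl
  classical
  -- the coefficients `(r k - c) * b k` change sign only at `n`
  obtain ⟨n, hn, hlt⟩ : ∃ n, c ≤ r n ∧ ∀ m < n, r m < c :=
    ⟨Nat.find hex, Nat.find_spec hex, fun m hm => not_le.1 (Nat.find_min hex hm)⟩
  have ht : 1 < z / y := (one_lt_div hy).2 hyz
  have hterm (k : ℕ) : (r k - c) * (b k * z ^ k) =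
      (z / y) ^ k * ((r k - c) * (b k * y ^ k)) := by
    rw [div_pow]
    field_simp
  have hle (k : ℕ) : (z / y) ^ n * ((r k - c) * (b k * y ^ k)) ≤
      (r k - c) * (b k * z ^ k) := by
    rw [hterm]
    have hbk := mul_pos (hb k) (pow_pos hy k)
    rcases lt_or_ge k n with hk | hk
    · exact mul_le_mul_of_nonpos_right (pow_le_pow_right₀ ht.le hk.le)
        (mul_nonpos_of_nonpos_of_nonneg (sub_nonpos.2 (hlt k hk).le) hbk.le)
    · exact mul_le_mul_of_nonneg_right (pow_le_pow_right₀ ht.le hk)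
        (mul_nonneg (sub_nonneg.2 (hn.trans (hr.monotone hk))) hbk.le)
  have hlt' : (z / y) ^ n * ((r (n + 1) - c) * (b (n + 1) * y ^ (n + 1))) <
      (r (n + 1) - c) * (b (n + 1) * z ^ (n + 1)) := by
    rw [hterm]
    exact mul_lt_mul_of_pos_right (pow_lt_pow_right₀ ht n.lt_succ_self)
      (mul_pos (sub_pos.2 (hn.trans_lt (hr n.lt_succ_self)))
        (mul_pos (hb _) (pow_pos hy _)))
  have hfin := hasSum_lt hle hlt' (hy0.mul_left _) (hdiff z hz)
  rw [mul_zero] at hfin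
  exact (lt_div_iff₀ (hB z hz)).2 (sub_pos.1 hfin)

/-- The quotient of the coefficients of `I_{μ+1}` and of the modified Lommel function, with
`p = (μ - ν + 3) / 2`, `q = (μ + ν + 3) / 2` and `s = μ + 2`, changes by the factor
`(k + p) (k + q) / ((k + 1) (k + s))`. -/
theorem gamma_quotient_succ {p q s : ℝ} (hp : 0 < p) (hq : 0 < q) (hs : 0 < s) (k : ℕ) :
    Gamma ((k + 1 : ℕ) + p) * Gamma ((k + 1 : ℕ) + q) /
        (Gamma ((k + 1 : ℕ) + 1) * Gamma ((k + 1 : ℕ) + s)) =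
      ((k + p) * (k + q) / ((k + 1) * (k + s))) *
        (Gamma (k + p) * Gamma (k + q) / (Gamma (k + 1) * Gamma (k + s))) := by
  have hadd (t : ℝ) (ht : 0 < t) : Gamma ((k + 1 : ℕ) + t) = (k + t) * Gamma (k + t) := by
    rw [← Gamma_add_one (by positivity)]
    push_cast
    ring_nf
  rw [hadd p hp, hadd q hq, hadd s hs, hadd 1 one_pos, div_mul_div_comm]
  ring_nf

/-- The quotient `I_{μ+1} / t̃_{μ,ν}` as a quotient of power series in `(x / 2) ^ 2`. -/
theorem modBessel_div_modLommel (μ ν : ℝ) {x : ℝ} (hx : 0 < x) :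
    modBessel (μ + 1) x / modLommel μ ν x =
      (∑' k : ℕ, 1 / (Gamma (k + 1) * Gamma (k + (μ + 2))) * ((x / 2) ^ 2) ^ k) /
        ∑' k : ℕ, 1 / (Gamma (k + (μ - ν + 3) / 2) * Gamma (k + (μ + ν + 3) / 2)) *
          ((x / 2) ^ 2) ^ k := by
  have hx2 : 0 < x / 2 := half_pos hx
  have hpow (k : ℕ) : (x / 2) ^ (μ + 1 + 2 * (k : ℝ)) =
      (x / 2) ^ (μ + 1) * ((x / 2) ^ 2) ^ k := by
    rw [rpow_add hx2, ← pow_mul, ← rpow_natCast]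
    push_cast
    rfl
  have hI : modBessel (μ + 1) x = (x / 2) ^ (μ + 1) *
      ∑' k : ℕ, 1 / (Gamma (k + 1) * Gamma (k + (μ + 2))) * ((x / 2) ^ 2) ^ k := by
    rw [modBessel, ← tsum_mul_left]
    refine tsum_congr fun k => ?_
    rw [add_comm (2 * (k : ℝ)), hpow, Gamma_nat_eq_factorial,
      show (k : ℝ) + (μ + 1) + 1 = k + (μ + 2) by ring]
    ring
  have hL : modLommel μ ν x = (x / 2) ^ (μ + 1) *
      ∑' k : ℕ, 1 / (Gamma (k + (μ - ν + 3) / 2) * Gamma (k + (μ + ν + 3) / 2)) *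
        ((x / 2) ^ 2) ^ k := by
    rw [modLommel, ← tsum_mul_left]
    refine tsum_congr fun k => ?_
    rw [show μ + 2 * (k : ℝ) + 1 = μ + 1 + 2 * k by ring, hpow]
    ring
  rw [hI, hL, mul_div_mul_left _ _ (rpow_pos_of_pos hx2 _).ne']

theorem stmt_2 (μ ν : ℝ) (hμ : μ > -2) :
    (|ν| < |μ + 1| →
      StrictMonoOn (fun x : ℝ => modBessel (μ + 1) x / modLommel μ ν x) (Set.Ioi (0 : ℝ))) ∧
    (|μ + 1| < |ν| → |ν| < μ + 3 →
      StrictAntiOn (fun x : ℝ => modBessel (μ + 1) x / modLommel μ ν x) (Set.Ioi (0 : ℝ))) := by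
  have hs : 0 < μ + 2 := by linarith
  set p := (μ - ν + 3) / 2 with hp_def
  set q := (μ + ν + 3) / 2 with hq_def
  set b : ℕ → ℝ := fun k => 1 / (Gamma (k + p) * Gamma (k + q)) with hb_def
  set r : ℕ → ℝ := fun k =>
    Gamma (k + p) * Gamma (k + q) / (Gamma (k + 1) * Gamma (k + (μ + 2))) with hr_def
  have hΓ (t : ℝ) (ht : 0 < t) (k : ℕ) : 0 < Gamma (k + t) := Gamma_pos_of_pos (by positivity)
  have hpq (h : |ν| < μ + 3) : 0 < p ∧ 0 < q := by
    obtain ⟨h₁, h₂⟩ := abs_lt.1 h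
    constructor <;> linarith
  have hb (h : |ν| < μ + 3) (k : ℕ) : 0 < b k :=
    one_div_pos.2 (mul_pos (hΓ p (hpq h).1 k) (hΓ q (hpq h).2 k))
  have hr (h : |ν| < μ + 3) (k : ℕ) : 0 < r k :=
    div_pos (mul_pos (hΓ p (hpq h).1 k) (hΓ q (hpq h).2 k))
      (mul_pos (hΓ 1 one_pos k) (hΓ _ hs k))
  have hrb (h : |ν| < μ + 3) (k : ℕ) :
      1 / (Gamma (k + 1) * Gamma (k + (μ + 2))) = r k * b k := by
    have := (hΓ p (hpq h).1 k).ne'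
    have := (hΓ q (hpq h).2 k).ne'
    simp only [hr_def, hb_def]
    field_simp
  have hsb (h : |ν| < μ + 3) (y : ℝ) (hy : 0 < y) : Summable fun k => b k * y ^ k :=
    summable_pow_div_gamma_mul_gamma (hpq h).1 (hpq h).2 hy
  have hsa (h : |ν| < μ + 3) (y : ℝ) (hy : 0 < y) : Summable fun k => r k * b k * y ^ k := by
    simpa only [hrb h] using summable_pow_div_gamma_mul_gamma one_pos hs hy
  have hquot (h : |ν| < μ + 3) {x : ℝ} (hx : 0 < x) : modBessel (μ + 1) x / modLommel μ ν x =
      (∑' k, r k * b k * ((x / 2) ^ 2) ^ k) / ∑' k, b k * ((x / 2) ^ 2) ^ k := by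
    simpa only [hrb h] using modBessel_div_modLommel μ ν hx
  have hsq {x y : ℝ} (hx : 0 < x) (hxy : x < y) : (x / 2) ^ 2 < (y / 2) ^ 2 := by gcongr
  have hcoef (k : ℕ) : ((k : ℝ) + p) * (k + q) - (k + 1) * (k + (μ + 2)) =
      ((μ + 1) ^ 2 - ν ^ 2) / 4 := by
    rw [hp_def, hq_def]
    ring
  have hden (k : ℕ) : (0 : ℝ) < (k + 1) * (k + (μ + 2)) := by positivity
  constructor
  · intro h
    have h3 : |ν| < μ + 3 := h.trans (abs_lt.2 ⟨by linarith, by linarith⟩)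
    have hmono : StrictMono r := strictMono_nat_of_lt_succ fun k => by
      have hk : 1 < ((k : ℝ) + p) * (k + q) / ((k + 1) * (k + (μ + 2))) := by
        rw [one_lt_div (hden k)]
        linarith [hcoef k, sq_lt_sq.2 h]
      simp only [hr_def]
      rw [gamma_quotient_succ (hpq h3).1 (hpq h3).2 hs k]
      exact lt_mul_of_one_lt_left (hr h3 k) hk
    intro x hx y hy hxy
    rw [Set.mem_Ioi] at hx hy
    simp only [hquot h3 hx, hquot h3 hy]
    exact strictMonoOn_tsum_div_tsum hmono (hb h3) (hsb h3) (hsa h3)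
      (Set.mem_Ioi.2 (by positivity)) (Set.mem_Ioi.2 (by positivity)) (hsq hx hxy)
  · intro h h3
    have hanti : StrictMono fun k => -r k := strictMono_nat_of_lt_succ fun k => by
      have hk : ((k : ℝ) + p) * (k + q) / ((k + 1) * (k + (μ + 2))) < 1 := by
        rw [div_lt_one (hden k)]
        linarith [hcoef k, sq_lt_sq.2 h]
      rw [neg_lt_neg_iff]
      simp only [hr_def]
      rw [gamma_quotient_succ (hpq h3).1 (hpq h3).2 hs k]
      exact mul_lt_of_lt_one_left (hr h3 k) hk
    intro x hx y hy hxy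
    rw [Set.mem_Ioi] at hx hy
    simp only [hquot h3 hx, hquot h3 hy]
    have hlt := strictMonoOn_tsum_div_tsum hanti (hb h3) (hsb h3)
      (fun y hy => by simpa only [neg_mul] using (hsa h3 y hy).neg)
      (Set.mem_Ioi.2 (show 0 < (x / 2) ^ 2 by positivity))
      (Set.mem_Ioi.2 (show 0 < (y / 2) ^ 2 by positivity)) (hsq hx hxy)
    simpa only [neg_mul, tsum_neg, neg_div, neg_lt_neg_iff] using hlt
end

section
/- Let μ, ν be real with μ > −3 and |ν| < μ+3. Then the function x ↦ x t̃'_{μ,ν}(x)/t̃_{μ,ν}(x) is strictly increasing on (0,∞), where t̃'_{μ,ν} denotes the derivative of t̃_{μ,ν} with respect to x. -/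
open Real

/-- If a real power series converges everywhere, so does the one with coefficients `k * a k`. -/
lemma summable_nat_mul_mul_pow {a : ℕ → ℝ} (hs : ∀ r : ℝ, Summable fun k => a k * r ^ k)
    (r : ℝ) : Summable fun k : ℕ => (k : ℝ) * (a k * r ^ k) := by
  refine Summable.of_norm_bounded (hs (2 * r)).norm fun k => ?_
  have hk : (k : ℝ) ≤ 2 ^ k := by exact_mod_cast Nat.lt_two_pow_self.le
  rw [mul_pow, mul_left_comm (a k), norm_mul, norm_mul ((2 : ℝ) ^ k)]
  gcongr
  rwa [Real.norm_of_nonneg (by positivity), Real.norm_of_nonneg (by positivity)]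

/-- Termwise differentiation of an everywhere convergent real power series. -/
lemma hasDerivAt_tsum_mul_pow {a : ℕ → ℝ} (hs : ∀ r : ℝ, Summable fun k => a k * r ^ k)
    (y : ℝ) : HasDerivAt (fun z => ∑' k, a k * z ^ k)
      (∑' k : ℕ, a k * (k * y ^ (k - 1))) y := by
  have hy : y ∈ Metric.ball (0 : ℝ) (|y| + 1) := by simp
  refine hasDerivAt_tsum_of_isPreconnected
    (summable_nat_mul_mul_pow hs (|y| + 1)).norm Metric.isOpen_ball
    (convex_ball _ _).isPreconnected (fun k z _ => (hasDerivAt_pow k z).const_mul (a k))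
    (fun k z hz => ?_) hy (hs y) hy
  have hz : |z| ≤ |y| + 1 := by simpa using (mem_ball_zero_iff.mp hz).le
  have h1 : |z| ^ (k - 1) ≤ (|y| + 1) ^ k :=
    (pow_le_pow_left₀ (abs_nonneg z) hz _).trans
      (pow_le_pow_right₀ (by linarith [abs_nonneg y]) (Nat.sub_le k 1))
  have h2 : ‖(|y| + 1) ^ k‖ = (|y| + 1) ^ k := Real.norm_of_nonneg (by positivity)
  rw [mul_left_comm, norm_mul, norm_mul, norm_mul, norm_mul, h2, norm_pow, Real.norm_eq_abs z]
  gcongr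

lemma mul_tsum_mul_pow_sub_one (a : ℕ → ℝ) (y : ℝ) :
    y * ∑' k : ℕ, a k * (k * y ^ (k - 1)) = ∑' k : ℕ, (k : ℝ) * (a k * y ^ k) := by
  rw [← tsum_mul_left]
  refine tsum_congr fun k => ?_
  cases k with
  | zero => simp
  | succ n => simp only [Nat.add_sub_cancel, pow_succ]; ring

/-- The logarithmic derivative with respect to `log y` of an everywhere convergent power series
with positive coefficients is strictly increasing. -/
lemma strictMonoOn_tsum_nat_mul_div_tsum {a : ℕ → ℝ} (ha : ∀ k, 0 < a k)
    (hs : ∀ r : ℝ, Summable fun k => a k * r ^ k) :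
    StrictMonoOn (fun y : ℝ => (∑' k : ℕ, (k : ℝ) * (a k * y ^ k)) / ∑' k, a k * y ^ k)
      (Set.Ioi 0) := by
  intro y (hy : 0 < y) z (hz : 0 < z) hyz
  have hpos : ∀ x : ℝ, 0 < x → 0 < ∑' k, a k * x ^ k := fun x hx =>
    (hs x).tsum_pos (fun k => by have := ha k; positivity) 0 (by simpa using ha 0)
  set m := (∑' k : ℕ, (k : ℝ) * (a k * y ^ k)) / ∑' k, a k * y ^ k with hm
  have hsub : ∀ x : ℝ, HasSum (fun k : ℕ => ((k : ℝ) - m) * (a k * x ^ k))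
      ((∑' k : ℕ, (k : ℝ) * (a k * x ^ k)) - m * ∑' k, a k * x ^ k) := fun x => by
    simpa only [sub_mul] using
      (summable_nat_mul_mul_pow hs x).hasSum.sub ((hs x).hasSum.mul_left m)
  have hy0 : (∑' k : ℕ, (k : ℝ) * (a k * y ^ k)) - m * ∑' k, a k * y ^ k = 0 := by
    rw [hm, div_mul_cancel₀ _ (hpos y hy).ne', sub_self]
  have hr : 1 < z / y := (one_lt_div hy).mpr hyz
  have hzy : ∀ k : ℕ, z ^ k = y ^ k * (z / y) ^ (k : ℝ) := fun k => by
    rw [rpow_natCast, ← mul_pow, mul_div_cancel₀ _ hy.ne']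
  have hlt : ∀ k : ℕ, (k : ℝ) ≠ m →
      (z / y) ^ m * (((k : ℝ) - m) * (a k * y ^ k)) < ((k : ℝ) - m) * (a k * z ^ k) := by
    intro k hk
    have hc : 0 < a k * y ^ k := mul_pos (ha k) (pow_pos hy k)
    have hprod : 0 < ((k : ℝ) - m) * ((z / y) ^ (k : ℝ) - (z / y) ^ m) := by
      rcases lt_or_gt_of_ne hk with h | h
      · exact mul_pos_of_neg_of_neg (sub_neg.mpr h)
          (sub_neg.mpr (rpow_lt_rpow_of_exponent_lt hr h))
      · exact mul_pos (sub_pos.mpr h) (sub_pos.mpr (rpow_lt_rpow_of_exponent_lt hr h))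
    rw [hzy k]
    linarith [mul_pos hc hprod]
  have hle : ∀ k : ℕ,
      (z / y) ^ m * (((k : ℝ) - m) * (a k * y ^ k)) ≤ ((k : ℝ) - m) * (a k * z ^ k) := by
    intro k
    by_cases hk : (k : ℝ) = m
    · simp [hk]
    · exact (hlt k hk).le
  obtain ⟨i, hi⟩ : ∃ i : ℕ, (i : ℝ) ≠ m := by
    by_contra! h
    have h0 := h 0
    have h1 := h 1
    norm_num at h0 h1
    linarith
  have key := hasSum_lt hle (hlt i hi) ((hsub y).mul_left ((z / y) ^ m)) (hsub z)
  rw [hy0, mul_zero] at key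
  exact (lt_div_iff₀ (hpos z hz)).mpr (sub_pos.mp key)

lemma summable_inv_Gamma_mul_Gamma_mul_pow {p q : ℝ} (hp : 0 < p) (hq : 0 < q) (r : ℝ) :
    Summable fun k : ℕ => (Gamma (k + p) * Gamma (k + q))⁻¹ * r ^ k := by
  rcases eq_or_ne r 0 with rfl | hr
  · exact summable_of_ne_finset_zero (s := {0}) fun k hk => by
      simp [show k ≠ 0 by simpa using hk]
  have hG : ∀ s : ℝ, 0 < s → ∀ k : ℕ, Gamma (k + s) ≠ 0 := fun s hs k =>
    (Gamma_pos_of_pos (by positivity)).ne'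
  refine summable_of_ratio_test_tendsto_lt_one (l := 0) one_pos
    (.of_forall fun k => mul_ne_zero (inv_ne_zero (mul_ne_zero (hG p hp k) (hG q hq k)))
      (pow_ne_zero k hr)) ?_
  have hinv : ∀ s : ℝ, Filter.Tendsto (fun k : ℕ => ((k : ℝ) + s)⁻¹) Filter.atTop (nhds 0) :=
    fun s => (Filter.tendsto_atTop_add_const_right _ s
      tendsto_natCast_atTop_atTop).inv_tendsto_atTop
  have hlim : Filter.Tendsto (fun k : ℕ => ‖((k : ℝ) + p)⁻¹ * ((k : ℝ) + q)⁻¹ * r‖)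
      Filter.atTop (nhds 0) := by
    simpa using (((hinv p).mul (hinv q)).mul_const r).norm
  refine hlim.congr fun k => ?_
  have hkp : (k : ℝ) + p ≠ 0 := by positivity
  have hkq : (k : ℝ) + q ≠ 0 := by positivity
  rw [← norm_div, Nat.cast_succ, add_right_comm, Gamma_add_one hkp, add_right_comm (k : ℝ) 1 q,
    Gamma_add_one hkq]
  congr 1
  have := hG p hp k
  have := hG q hq k
  rw [pow_succ]
  field_simp

lemma modLommel_eq_rpow_mul_tsum (μ ν : ℝ) {x : ℝ} (hx : 0 < x) :
    modLommel μ ν x = (x / 2) ^ (μ + 1) * ∑' k : ℕ,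
      (Gamma (k + (μ - ν + 3) / 2) * Gamma (k + (μ + ν + 3) / 2))⁻¹ * ((x / 2) ^ 2) ^ k := by
  rw [modLommel, ← tsum_mul_left]
  refine tsum_congr fun k => ?_
  rw [show μ + 2 * (k : ℝ) + 1 = (μ + 1) + ((2 * k : ℕ) : ℝ) by push_cast; ring,
    rpow_add (by positivity), rpow_natCast, pow_mul]
  ring

theorem stmt_4 (μ ν : ℝ) (hμ : μ > -3) (hν : |ν| < μ + 3) :
    StrictMonoOn (fun x : ℝ => x * deriv (modLommel μ ν) x / modLommel μ ν x)
      (Set.Ioi (0 : ℝ)) := by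
  obtain ⟨hν₁, hν₂⟩ := abs_lt.mp hν
  have hp : 0 < (μ - ν + 3) / 2 := by linarith
  have hq : 0 < (μ + ν + 3) / 2 := by linarith
  set a : ℕ → ℝ := fun k =>
    (Gamma (k + (μ - ν + 3) / 2) * Gamma (k + (μ + ν + 3) / 2))⁻¹
  have ha : ∀ k, 0 < a k := fun k => inv_pos.mpr
    (mul_pos (Gamma_pos_of_pos (by positivity)) (Gamma_pos_of_pos (by positivity)))
  have hs : ∀ r : ℝ, Summable fun k => a k * r ^ k :=
    summable_inv_Gamma_mul_Gamma_mul_pow hp hq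
  have hmono : StrictMonoOn (fun x : ℝ => (μ + 1) + 2 *
      ((∑' k : ℕ, (k : ℝ) * (a k * ((x / 2) ^ 2) ^ k)) / ∑' k, a k * ((x / 2) ^ 2) ^ k))
      (Set.Ioi 0) := by
    intro x (hx : 0 < x) y (hy : 0 < y) hxy
    have hsq : (x / 2) ^ 2 < (y / 2) ^ 2 := by gcongr
    have := strictMonoOn_tsum_nat_mul_div_tsum ha hs
      (Set.mem_Ioi.mpr (by positivity : 0 < (x / 2) ^ 2))
      (Set.mem_Ioi.mpr (by positivity : 0 < (y / 2) ^ 2)) hsq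
    dsimp only at this ⊢
    linarith
  refine hmono.congr fun x (hx : 0 < x) => ?_
  have hx2 : 0 < x / 2 := by positivity
  have hg : 0 < ∑' k, a k * ((x / 2) ^ 2) ^ k :=
    (hs _).tsum_pos (fun k => by have := ha k; positivity) 0 (by simpa using ha 0)
  have hhalf : HasDerivAt (fun t : ℝ => t / 2) (1 / 2) x := (hasDerivAt_id x).div_const 2
  have hd := (hhalf.rpow_const (p := μ + 1) (Or.inl hx2.ne')).mul
    ((hasDerivAt_tsum_mul_pow hs ((x / 2) ^ 2)).comp x (hhalf.pow 2))
  have heq : modLommel μ ν =ᶠ[nhds x] fun t => (t / 2) ^ (μ + 1) *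
      ∑' k, a k * ((t / 2) ^ 2) ^ k := by
    filter_upwards [Ioi_mem_nhds hx] with t ht
    exact modLommel_eq_rpow_mul_tsum μ ν ht
  have hderiv := (hd.congr_of_eventuallyEq heq).deriv
  have hpow : (x / 2) ^ (μ + 1) = (x / 2) ^ μ * (x / 2) := rpow_add_one hx2.ne' μ
  have hμpos : 0 < (x / 2) ^ μ := rpow_pos_of_pos hx2 μ
  dsimp only
  rw [hderiv, heq.eq_of_nhds, ← mul_tsum_mul_pow_sub_one]
  simp only [Function.comp_apply, Pi.pow_apply, add_sub_cancel_right, hpow]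
  generalize (∑' k, a k * ((x / 2) ^ 2) ^ k) = g at hg ⊢
  generalize (∑' k : ℕ, a k * (k * ((x / 2) ^ 2) ^ (k - 1))) = g'
  generalize (x / 2) ^ μ = w at hμpos ⊢
  field_simp
  ring
end

section
/- Let μ, ν be real with μ > −3/2 and |μ| > |ν|. Then for all x > 0, t̃_{μ,ν}(x) < (√π Γ(μ+3/2) / (2 Γ((μ−ν+3)/2) Γ((μ+ν+3)/2))) · L_μ(x). The inequality is reversed (with strict >) for all x > 0 if μ > −3/2 and |μ| < |ν| < μ+3. -/
open Real

lemma Gamma_natCast_succ_add {z : ℝ} (hz : 0 < z) (k : ℕ) :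
    Gamma (((k + 1 : ℕ) : ℝ) + z) = (k + z) * Gamma (k + z) := by
  rw [← Gamma_add_one (by positivity)]
  congr 1
  push_cast
  ring

/-- If `a + b = c + d` and `c * d < a * b`, then the rising factorials satisfy
`(c)_k (d)_k ≤ (a)_k (b)_k`, written with Gamma values. -/
lemma Gamma_add_nat_mul_le {a b c d : ℝ} (ha : 0 < a) (hb : 0 < b) (hc : 0 < c) (hd : 0 < d)
    (hsum : a + b = c + d) (hprod : c * d < a * b) (k : ℕ) :
    Gamma (k + c) * Gamma (k + d) * (Gamma a * Gamma b) ≤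
      Gamma (k + a) * Gamma (k + b) * (Gamma c * Gamma d) := by
  induction k with
  | zero => simp [mul_comm]
  | succ k ih =>
    rw [Gamma_natCast_succ_add ha, Gamma_natCast_succ_add hb, Gamma_natCast_succ_add hc,
      Gamma_natCast_succ_add hd]
    have hfac : (k + c) * (k + d) ≤ (k + a) * (k + b) := by
      have : (k : ℝ) * (a + b) = k * (c + d) := by rw [hsum]
      nlinarith
    have hcd : 0 < Gamma (k + a) * Gamma (k + b) * (Gamma c * Gamma d) := by
      have := Gamma_pos_of_pos (show 0 < k + a by positivity)
      have := Gamma_pos_of_pos (show 0 < k + b by positivity)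
      have := Gamma_pos_of_pos hc
      have := Gamma_pos_of_pos hd
      positivity
    calc (k + c) * Gamma (k + c) * ((k + d) * Gamma (k + d)) * (Gamma a * Gamma b)
        = (k + c) * (k + d) * (Gamma (k + c) * Gamma (k + d) * (Gamma a * Gamma b)) := by ring
      _ ≤ (k + a) * (k + b) * (Gamma (k + a) * Gamma (k + b) * (Gamma c * Gamma d)) :=
          mul_le_mul hfac ih (by
            have := Gamma_pos_of_pos (show 0 < k + c by positivity)
            have := Gamma_pos_of_pos (show 0 < k + d by positivity)
            have := Gamma_pos_of_pos ha
            have := Gamma_pos_of_pos hb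
            positivity) (by positivity)
      _ = _ := by ring

lemma summable_rpow_div_Gamma_mul_Gamma {a b y : ℝ} (s : ℝ) (ha : 0 < a) (hb : 0 < b)
    (hy : 0 < y) :
    Summable fun k : ℕ => y ^ (s + 2 * (k : ℝ)) / (Gamma (k + a) * Gamma (k + b)) := by
  have hpos : ∀ z : ℝ, 0 < z → ∀ k : ℕ, 0 < Gamma (k + z) := fun z hz k =>
    Gamma_pos_of_pos (by positivity)
  refine summable_of_ratio_test_tendsto_lt_one (l := 0) one_pos
    (Filter.Eventually.of_forall fun k => ?_) ?_
  · have := hpos a ha k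
    have := hpos b hb k
    positivity
  · have hlim : ∀ z : ℝ, Filter.Tendsto (fun k : ℕ => ((k : ℝ) + z)⁻¹) Filter.atTop (nhds 0) :=
      fun z => (Filter.tendsto_atTop_add_const_right _ z
        tendsto_natCast_atTop_atTop).inv_tendsto_atTop
    have h := ((hlim a).mul (hlim b)).const_mul (y ^ 2)
    simp only [mul_zero] at h
    refine h.congr fun k => ?_
    have hA := hpos a ha k
    have hB := hpos b hb k
    have hpow : y ^ (s + 2 * ((k + 1 : ℕ) : ℝ)) = y ^ (s + 2 * (k : ℝ)) * y ^ 2 := by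
      rw [← rpow_natCast y 2, ← rpow_add hy]
      congr 1
      push_cast
      ring
    have hY : 0 < y ^ (s + 2 * (k : ℝ)) := by positivity
    have hka : (k : ℝ) + a ≠ 0 := by positivity
    have hkb : (k : ℝ) + b ≠ 0 := by positivity
    rw [hpow, Gamma_natCast_succ_add ha, Gamma_natCast_succ_add hb,
      Real.norm_of_nonneg (by positivity), Real.norm_of_nonneg (by positivity)]
    field_simp

lemma Gamma_mul_tsum_lt {a b c d y : ℝ} (s : ℝ) (ha : 0 < a) (hb : 0 < b) (hc : 0 < c)
    (hd : 0 < d) (hsum : a + b = c + d) (hprod : c * d < a * b) (hy : 0 < y) :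
    Gamma a * Gamma b *
        ∑' k : ℕ, y ^ (s + 2 * (k : ℝ)) / (Gamma (k + a) * Gamma (k + b)) <
      Gamma c * Gamma d *
        ∑' k : ℕ, y ^ (s + 2 * (k : ℝ)) / (Gamma (k + c) * Gamma (k + d)) := by
  have hpos : ∀ z : ℝ, 0 < z → ∀ k : ℕ, 0 < Gamma (k + z) := fun z hz k =>
    Gamma_pos_of_pos (by positivity)
  rw [← tsum_mul_left, ← tsum_mul_left]
  refine Summable.tsum_lt_tsum (i := 1) (fun k => ?_) ?_
    ((summable_rpow_div_Gamma_mul_Gamma s ha hb hy).mul_left _)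
    ((summable_rpow_div_Gamma_mul_Gamma s hc hd hy).mul_left _)
  · have := hpos a ha k
    have := hpos b hb k
    have := hpos c hc k
    have := hpos d hd k
    have hY : 0 < y ^ (s + 2 * (k : ℝ)) := by positivity
    rw [mul_div_assoc', mul_div_assoc', div_le_div_iff₀ (by positivity) (by positivity)]
    have := mul_le_mul_of_nonneg_left (Gamma_add_nat_mul_le ha hb hc hd hsum hprod k) hY.le
    linarith
  · have hA := Gamma_pos_of_pos ha
    have hB := Gamma_pos_of_pos hb
    have hC := Gamma_pos_of_pos hc
    have hD := Gamma_pos_of_pos hd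
    have hY : 0 < y ^ (s + 2 * ((1 : ℕ) : ℝ)) := by positivity
    have step : ∀ z : ℝ, 0 < z → Gamma (((1 : ℕ) : ℝ) + z) = z * Gamma z := by
      intro z hz
      rw [← Gamma_add_one hz.ne', Nat.cast_one, add_comm]
    rw [step a ha, step b hb, step c hc, step d hd]
    have key : ∀ p q P Q Y : ℝ, 0 < p → 0 < q → 0 < P → 0 < Q →
        P * Q * (Y / (p * P * (q * Q))) = Y / (p * q) := by
      intros
      field_simp
    rw [key a b _ _ _ ha hb hA hB, key c d _ _ _ hc hd hC hD]
    exact div_lt_div_of_pos_left hY (by positivity) hprod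

lemma modLommel_eq_tsum (μ ν x : ℝ) :
    modLommel μ ν x = ∑' k : ℕ, (x / 2) ^ (μ + 1 + 2 * (k : ℝ)) /
      (Gamma (k + (μ - ν + 3) / 2) * Gamma (k + (μ + ν + 3) / 2)) := by
  unfold modLommel
  refine tsum_congr fun k => ?_
  rw [add_right_comm]

lemma modStruve_eq_tsum (μ x : ℝ) :
    modStruve μ x = ∑' k : ℕ, (x / 2) ^ (μ + 1 + 2 * (k : ℝ)) /
      (Gamma (k + 3 / 2) * Gamma (k + (μ + 3 / 2))) := by
  unfold modStruve
  refine tsum_congr fun k => ?_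
  rw [← add_assoc (k : ℝ) μ, show 2 * (k : ℝ) + μ + 1 = μ + 1 + 2 * k by ring]

lemma Gamma_three_halves : Gamma (3 / 2) = √π / 2 := by
  rw [show (3 / 2 : ℝ) = 1 / 2 + 1 by norm_num, Gamma_add_one (by norm_num), Gamma_one_half_eq]
  ring

theorem stmt_7 (μ ν : ℝ) (hμ : μ > -3/2) :
    (|μ| > |ν| → ∀ x : ℝ, 0 < x →
      modLommel μ ν x <
        Real.sqrt π * Gamma (μ + 3/2) /
          (2 * Gamma ((μ - ν + 3) / 2) * Gamma ((μ + ν + 3) / 2)) * modStruve μ x) ∧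
    (|μ| < |ν| → |ν| < μ + 3 → ∀ x : ℝ, 0 < x →
      modLommel μ ν x >
        Real.sqrt π * Gamma (μ + 3/2) /
          (2 * Gamma ((μ - ν + 3) / 2) * Gamma ((μ + ν + 3) / 2)) * modStruve μ x) := by
  have hd : 0 < μ + 3 / 2 := by linarith
  have hc : (0 : ℝ) < 3 / 2 := by norm_num
  have hsum : (μ - ν + 3) / 2 + (μ + ν + 3) / 2 = 3 / 2 + (μ + 3 / 2) := by ring
  have hcoef : ∀ A B S : ℝ, √π * Gamma (μ + 3 / 2) / (2 * A * B) * S =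
      Gamma (3 / 2) * Gamma (μ + 3 / 2) * S / (A * B) := by
    intro A B S
    rw [Gamma_three_halves, mul_assoc 2 A B, ← div_div]
    ring
  refine ⟨fun h x hx => ?_, fun h h3 x hx => ?_⟩
  · have hν : |ν| < μ + 3 := by
      rcases abs_cases μ with ⟨e, _⟩ | ⟨e, _⟩ <;> linarith
    obtain ⟨h1, h2⟩ := abs_lt.mp hν
    have ha : 0 < (μ - ν + 3) / 2 := by linarith
    have hb : 0 < (μ + ν + 3) / 2 := by linarith
    have hsq := sq_lt_sq.mpr h
    rw [hcoef, lt_div_iff₀' (mul_pos (Gamma_pos_of_pos ha) (Gamma_pos_of_pos hb)),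
      modLommel_eq_tsum, modStruve_eq_tsum]
    exact Gamma_mul_tsum_lt _ ha hb hc hd hsum (by linarith) (by positivity)
  · obtain ⟨h1, h2⟩ := abs_lt.mp h3
    have ha : 0 < (μ - ν + 3) / 2 := by linarith
    have hb : 0 < (μ + ν + 3) / 2 := by linarith
    have hsq := sq_lt_sq.mpr h
    rw [gt_iff_lt, hcoef, div_lt_iff₀' (mul_pos (Gamma_pos_of_pos ha) (Gamma_pos_of_pos hb)),
      modLommel_eq_tsum, modStruve_eq_tsum]
    exact Gamma_mul_tsum_lt _ hc hd ha hb hsum.symm (by linarith) (by positivity)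
end

section
/- Let μ, ν be real with μ > −3 and |ν| < μ+3. Then for all x > 0, x t̃'_{μ,ν}(x)/t̃_{μ,ν}(x) > μ + 1, where t̃'_{μ,ν} denotes the derivative of t̃_{μ,ν} with respect to x. -/
open Real

/-- The series `∑ r ^ k / (Γ(k + a) Γ(k + b))` converges for every `r > 0`. -/
lemma summable_pow_div_Gamma_mul_Gamma {a b : ℝ} (ha : 0 < a) (hb : 0 < b) {r : ℝ} (hr : 0 < r) :
    Summable fun k : ℕ => (Gamma (k + a) * Gamma (k + b))⁻¹ * r ^ k := by
  have hpos (k : ℕ) : 0 < (Gamma (k + a) * Gamma (k + b))⁻¹ * r ^ k := by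
    have := Gamma_pos_of_pos (show 0 < (k : ℝ) + a by positivity)
    have := Gamma_pos_of_pos (show 0 < (k : ℝ) + b by positivity)
    positivity
  refine summable_of_ratio_test_tendsto_lt_one (l := 0) one_pos
    (.of_forall fun k => (hpos k).ne') ?_
  have hratio (k : ℕ) : ‖(Gamma ((k + 1 : ℕ) + a) * Gamma ((k + 1 : ℕ) + b))⁻¹ * r ^ (k + 1)‖ /
      ‖(Gamma (k + a) * Gamma (k + b))⁻¹ * r ^ k‖ = r * ((k + a)⁻¹ * (k + b)⁻¹) := by
    have hka : 0 < (k : ℝ) + a := by positivity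
    have hkb : 0 < (k : ℝ) + b := by positivity
    have := Gamma_pos_of_pos hka
    have := Gamma_pos_of_pos hkb
    rw [norm_of_nonneg (hpos k).le, norm_of_nonneg (hpos (k + 1)).le, Nat.cast_succ,
      add_right_comm, add_right_comm (k : ℝ) 1 b, Gamma_add_one hka.ne', Gamma_add_one hkb.ne', pow_succ]
    field_simp
  simp_rw [hratio]
  have hinv (d : ℝ) : Filter.Tendsto (fun k : ℕ => ((k : ℝ) + d)⁻¹) Filter.atTop (nhds 0) :=
    tendsto_inv_atTop_zero.comp
      (Filter.tendsto_atTop_add_const_right _ d tendsto_natCast_atTop_atTop)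
  simpa using ((hinv a).mul (hinv b)).const_mul r

/-- A power series with positive coefficients that converges everywhere has a positive derivative
on the positive half-line. -/
lemma exists_pos_hasDerivAt_tsum_mul_pow {c : ℕ → ℝ} (hc : ∀ k, 0 < c k)
    (hs : ∀ r : ℝ, 0 < r → Summable fun k => c k * r ^ k) {y : ℝ} (hy : 0 < y) :
    ∃ D, 0 < D ∧ HasDerivAt (fun z => ∑' k, c k * z ^ k) D y := by
  obtain ⟨R, hyR⟩ := exists_gt y
  have hR : 0 < R := hy.trans hyR
  have hbound (k : ℕ) (z : ℝ) (hz : z ∈ Set.Ioo 0 R) :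
      ‖c k * (k * z ^ (k - 1))‖ ≤ c k * (2 * R) ^ k / R := by
    have hck := hc k
    have hz0 := hz.1
    rw [norm_of_nonneg (by positivity), mul_div_assoc]
    gcongr
    rcases k with _ | k
    · simp [hR.le]
    · rw [le_div_iff₀ hR, mul_pow, mul_assoc, Nat.add_sub_cancel, pow_succ R k]
      have hk : ((k + 1 : ℕ) : ℝ) ≤ 2 ^ (k + 1) := by exact_mod_cast Nat.lt_two_pow_self.le
      have := hz.2.le
      gcongr
  have hu : Summable fun k => c k * (2 * R) ^ k / R := (hs _ (by positivity)).div_const R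
  have hmem : y ∈ Set.Ioo 0 R := ⟨hy, hyR⟩
  refine ⟨∑' k : ℕ, c k * (k * y ^ (k - 1)), ?_,
    hasDerivAt_tsum_of_isPreconnected hu isOpen_Ioo isPreconnected_Ioo
      (fun k z _ => (hasDerivAt_pow k z).const_mul (c k)) hbound hmem (hs y hy) hmem⟩
  refine (Summable.of_norm_bounded hu fun k => hbound k y hmem).tsum_pos (fun k => ?_) 1 ?_
  · have := hc k
    positivity
  · simpa using hc 1

theorem stmt_10 (μ ν : ℝ) (hμ : μ > -3) (hν : |ν| < μ + 3) :
    ∀ x : ℝ, 0 < x → x * deriv (modLommel μ ν) x / modLommel μ ν x > μ + 1 := by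
  intro x hx
  obtain ⟨hν₁, hν₂⟩ := abs_lt.mp hν
  have ha : 0 < (μ - ν + 3) / 2 := by linarith
  have hb : 0 < (μ + ν + 3) / 2 := by linarith
  set c : ℕ → ℝ := fun k =>
    (Gamma (k + (μ - ν + 3) / 2) * Gamma (k + (μ + ν + 3) / 2))⁻¹
  have hc (k : ℕ) : 0 < c k := inv_pos.mpr <|
    mul_pos (Gamma_pos_of_pos (by positivity)) (Gamma_pos_of_pos (by positivity))
  have hs (r : ℝ) (hr : 0 < r) : Summable fun k => c k * r ^ k :=
    summable_pow_div_Gamma_mul_Gamma ha hb hr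
  have hx2 : 0 < x / 2 := by positivity
  have hy : 0 < (x / 2) ^ 2 := by positivity
  obtain ⟨D, hD, hderiv⟩ := exists_pos_hasDerivAt_tsum_mul_pow hc hs hy
  have hF : 0 < ∑' k, c k * ((x / 2) ^ 2) ^ k :=
    (hs _ hy).tsum_pos (fun k => by have := hc k; positivity) 0 (by simpa using hc 0)
  have hlin : HasDerivAt (fun z : ℝ => z / 2) (1 / 2) x := (hasDerivAt_id x).div_const 2
  have hcomp : HasDerivAt (fun z : ℝ => ∑' k, c k * ((z / 2) ^ 2) ^ k) (D * (x / 2)) x := by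
    refine (HasDerivAt.comp (h := fun z : ℝ => (z / 2) ^ 2) x hderiv (hlin.pow 2)).congr_deriv ?_
    push_cast
    ring
  have hprod := (hlin.rpow_const (p := μ + 1) (.inl hx2.ne')).mul hcomp
  have hev : modLommel μ ν =ᶠ[nhds x]
      (fun z : ℝ => (z / 2) ^ (μ + 1)) * fun z : ℝ => ∑' k, c k * ((z / 2) ^ 2) ^ k := by
    filter_upwards [lt_mem_nhds hx] with z hz using modLommel_eq_rpow_mul_tsum μ ν hz
  rw [(hprod.congr_of_eventuallyEq hev).deriv, modLommel_eq_rpow_mul_tsum μ ν hx, gt_iff_lt]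
  change μ + 1 < _ / (_ * ∑' k, c k * ((x / 2) ^ 2) ^ k)
  have hP : 0 < (x / 2) ^ (μ + 1) := rpow_pos_of_pos hx2 _
  rw [lt_div_iff₀ (by positivity), rpow_sub_one hx2.ne']
  generalize (x / 2) ^ (μ + 1) = P at *
  generalize (∑' k, c k * ((x / 2) ^ 2) ^ k) = F at *
  have hexpand : x * (1 / 2 * (μ + 1) * (P / (x / 2)) * F + P * (D * (x / 2))) =
      (μ + 1) * (P * F) + P * D * x ^ 2 / 2 := by
    field_simp
  rw [hexpand]
  have : 0 < P * D * x ^ 2 / 2 := by positivity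
  linarith
end

section
/- Let μ, ν be real with μ > −3 and |ν| < μ+3. Then for all x > 0, |x t̃'_{μ,ν}(x)/t̃_{μ,ν}(x)| < √(x² + ν² + 2(μ+ν+1) b_{μ,ν}(x)), where t̃'_{μ,ν} denotes the derivative of t̃_{μ,ν} with respect to x. -/
open Real

/-- The function `a_{μ,ν}(x)`. -/
noncomputable def aLommel (μ ν x : ℝ) : ℝ :=
  (x / 2) ^ μ / (Gamma ((μ - ν + 1) / 2) * Gamma ((μ + ν + 3) / 2))

/-- The function `b_{μ,ν}(x)`. -/
noncomputable def bLommel (μ ν x : ℝ) : ℝ :=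
  x * aLommel μ ν x / (2 * modLommel μ ν x)

/-- The coefficients of the power series `∑ zᵏ / (Γ(k+A) Γ(k+B))`. -/
noncomputable def lommelCoeff (A B : ℝ) (k : ℕ) : ℝ := 1 / (Gamma (k + A) * Gamma (k + B))

lemma lommelCoeff_pos {A B : ℝ} (hA : 0 < A) (hB : 0 < B) (k : ℕ) : 0 < lommelCoeff A B k := by
  have h₁ : 0 < Gamma (k + A) := Gamma_pos_of_pos (by positivity)
  have h₂ : 0 < Gamma (k + B) := Gamma_pos_of_pos (by positivity)
  unfold lommelCoeff
  positivity

lemma lommelCoeff_succ {A B : ℝ} (hA : 0 < A) (hB : 0 < B) (k : ℕ) :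
    (k + A) * (k + B) * lommelCoeff A B (k + 1) = lommelCoeff A B k := by
  have hkA : (0 : ℝ) < k + A := by positivity
  have hkB : (0 : ℝ) < k + B := by positivity
  have h₁ := (Gamma_pos_of_pos hkA).ne'
  have h₂ := (Gamma_pos_of_pos hkB).ne'
  unfold lommelCoeff
  rw [show ((k + 1 : ℕ) : ℝ) + A = (k + A) + 1 by push_cast; ring,
    show ((k + 1 : ℕ) : ℝ) + B = (k + B) + 1 by push_cast; ring,
    Gamma_add_one hkA.ne', Gamma_add_one hkB.ne']
  field_simp

lemma summable_lommelCoeff_mul_pow {A B : ℝ} (hA : 0 < A) (hB : 0 < B) {z : ℝ} (hz : 0 < z) :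
    Summable fun k : ℕ => lommelCoeff A B k * z ^ k := by
  have hratio : ∀ k : ℕ, ‖lommelCoeff A B (k + 1) * z ^ (k + 1)‖ / ‖lommelCoeff A B k * z ^ k‖
      = z * ((k + A)⁻¹ * (k + B)⁻¹) := by
    intro k
    have h₀ := lommelCoeff_pos hA hB k
    have h₁ := lommelCoeff_pos hA hB (k + 1)
    rw [norm_of_nonneg (by positivity), norm_of_nonneg (by positivity),
      ← lommelCoeff_succ hA hB k]
    have : (0 : ℝ) < k + A := by positivity
    have : (0 : ℝ) < k + B := by positivity
    field_simp
    ring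
  refine summable_of_ratio_test_tendsto_lt_one (l := 0) one_pos
    (Filter.Eventually.of_forall fun k => ?_) ?_
  · have := lommelCoeff_pos hA hB k
    positivity
  · simp_rw [hratio]
    have key : ∀ C : ℝ, Filter.Tendsto (fun k : ℕ => ((k : ℝ) + C)⁻¹) Filter.atTop (nhds 0) :=
      fun C => (Filter.tendsto_atTop_add_const_right _ C
        tendsto_natCast_atTop_atTop).inv_tendsto_atTop
    simpa using ((key A).mul (key B)).const_mul z

lemma natCast_mul_pow_pred_le {R : ℝ} (hR : 1 ≤ R) (k : ℕ) :
    (k : ℝ) * R ^ (k - 1) ≤ (2 * R) ^ k := by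
  rw [mul_pow]
  have h : (k : ℝ) ≤ 2 ^ k := by exact_mod_cast Nat.lt_two_pow_self.le
  gcongr
  omega

lemma summable_lommelCoeff_deriv {A B : ℝ} (hA : 0 < A) (hB : 0 < B) {z : ℝ} (hz : 0 < z) :
    Summable fun k : ℕ => lommelCoeff A B k * (k * z ^ (k - 1)) := by
  refine Summable.of_nonneg_of_le (fun k => ?_) (fun k => ?_)
    (summable_lommelCoeff_mul_pow hA hB (z := 2 * (z + 1)) (by positivity))
  · have := lommelCoeff_pos hA hB k
    positivity
  · have := lommelCoeff_pos hA hB k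
    have h := natCast_mul_pow_pred_le (R := z + 1) (by linarith) k
    refine mul_le_mul_of_nonneg_left (le_trans ?_ h) this.le
    gcongr
    linarith

lemma hasDerivAt_tsum_lommelCoeff {A B : ℝ} (hA : 0 < A) (hB : 0 < B) {z : ℝ} (hz : 0 < z) :
    HasDerivAt (fun w : ℝ => ∑' k : ℕ, lommelCoeff A B k * w ^ k)
      (∑' k : ℕ, lommelCoeff A B k * (k * z ^ (k - 1))) z := by
  refine hasDerivAt_tsum_of_isPreconnected (t := Set.Ioo 0 (z + 1))
    (g := fun (k : ℕ) (w : ℝ) => lommelCoeff A B k * w ^ k)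
    (g' := fun (k : ℕ) (w : ℝ) => lommelCoeff A B k * (k * w ^ (k - 1)))
    (summable_lommelCoeff_deriv hA hB (z := z + 1) (by positivity))
    isOpen_Ioo isPreconnected_Ioo (fun k w _ => (hasDerivAt_pow k w).const_mul _)
    (fun k w hw => ?_) (y₀ := z) ⟨hz, by linarith⟩ (summable_lommelCoeff_mul_pow hA hB hz)
    ⟨hz, by linarith⟩
  have h₀ := lommelCoeff_pos hA hB k
  have hw₀ := hw.1
  rw [norm_of_nonneg (by positivity)]
  have := hw.2.le
  gcongr

/-- The Cauchy–Schwarz inequality for the weights `cₖ zᵏ`: the square of the mean of `s + 2k` is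
less than its second moment, evaluated here through the recurrence of the coefficients. -/
lemma sq_mean_lt_second_moment {A B : ℝ} (hA : 0 < A) (hB : 0 < B) {z : ℝ} (hz : 0 < z)
    {G D : ℝ} (hG : HasSum (fun k : ℕ => lommelCoeff A B k * z ^ k) G)
    (hD : HasSum (fun k : ℕ => lommelCoeff A B k * (k * z ^ (k - 1))) D) :
    (A + B - 2 + 2 * z * D / G) ^ 2 <
      4 * z + (A - B) ^ 2 + 4 * (A - 1) * (B - 1) * lommelCoeff A B 0 / G := by
  have hpos : ∀ k : ℕ, 0 < lommelCoeff A B k * z ^ k := fun k =>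
    mul_pos (lommelCoeff_pos hA hB k) (by positivity)
  have hGpos : 0 < G := (hpos 0).trans_le (le_hasSum hG 0 fun k _ => (hpos k).le)
  have hfirst : HasSum (fun k : ℕ => k * (lommelCoeff A B k * z ^ k)) (z * D) := by
    have hterm : (fun k : ℕ => k * (lommelCoeff A B k * z ^ k))
        = fun k : ℕ => z * (lommelCoeff A B k * (k * z ^ (k - 1))) := by
      funext k
      cases k with
      | zero => simp
      | succ n =>
        rw [Nat.add_sub_cancel, pow_succ]
        ring
    exact hterm ▸ hD.mul_left z
  have hsecond : HasSum (fun k : ℕ => (k + A - 1) * (k + B - 1) * (lommelCoeff A B k * z ^ k))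
      (z * G + (A - 1) * (B - 1) * lommelCoeff A B 0) := by
    rw [← hasSum_nat_add_iff' 1]
    have hterm : (fun k : ℕ => (((k + 1 : ℕ) : ℝ) + A - 1) * (((k + 1 : ℕ) : ℝ) + B - 1)
        * (lommelCoeff A B (k + 1) * z ^ (k + 1))) =
        fun k : ℕ => z * (lommelCoeff A B k * z ^ k) := by
      funext k
      rw [← lommelCoeff_succ hA hB k]
      push_cast
      ring
    rw [hterm]
    simpa using hG.mul_left z
  set m := A + B - 2 + 2 * z * D / G with hm
  have hmG : m * G = (A + B - 2) * G + 2 * z * D := by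
    rw [hm]; field_simp
  have hvar : HasSum (fun k : ℕ => (A + B - 2 + 2 * k - m) ^ 2 * (lommelCoeff A B k * z ^ k))
      (4 * z * G + (A - B) ^ 2 * G + 4 * (A - 1) * (B - 1) * lommelCoeff A B 0 - m ^ 2 * G) := by
    have h := ((hsecond.mul_left 4).add
      (hG.mul_left ((A - B) ^ 2 - 2 * m * (A + B - 2) + m ^ 2))).sub (hfirst.mul_left (4 * m))
    have hvalue : 4 * (z * G + (A - 1) * (B - 1) * lommelCoeff A B 0)
        + ((A - B) ^ 2 - 2 * m * (A + B - 2) + m ^ 2) * G - 4 * m * (z * D)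
        = 4 * z * G + (A - B) ^ 2 * G + 4 * (A - 1) * (B - 1) * lommelCoeff A B 0
          - m ^ 2 * G := by
      linear_combination (2 * m) * hmG
    rw [hvalue] at h
    have hterm : (fun k : ℕ => (A + B - 2 + 2 * k - m) ^ 2 * (lommelCoeff A B k * z ^ k))
        = fun k : ℕ => 4 * ((k + A - 1) * (k + B - 1) * (lommelCoeff A B k * z ^ k))
          + ((A - B) ^ 2 - 2 * m * (A + B - 2) + m ^ 2) * (lommelCoeff A B k * z ^ k)
          - 4 * m * (k * (lommelCoeff A B k * z ^ k)) := by
      funext k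
      ring
    exact hterm ▸ h
  have hnn : ∀ k : ℕ, 0 ≤ (A + B - 2 + 2 * k - m) ^ 2 * (lommelCoeff A B k * z ^ k) := fun k =>
    mul_nonneg (sq_nonneg _) (hpos k).le
  have hvarpos : 0 < 4 * z * G + (A - B) ^ 2 * G + 4 * (A - 1) * (B - 1) * lommelCoeff A B 0
      - m ^ 2 * G := by
    by_cases h : A + B - 2 - m = 0
    · refine lt_of_lt_of_le ?_ (le_hasSum hvar 1 fun k _ => hnn k)
      refine mul_pos (pow_pos ?_ 2) (hpos 1)
      push_cast
      linarith
    · refine lt_of_lt_of_le ?_ (le_hasSum hvar 0 fun k _ => hnn k)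
      refine mul_pos (sq_pos_of_ne_zero ?_) (hpos 0)
      simpa using h
  rw [← mul_lt_mul_iff_left₀ hGpos, add_mul, div_mul_cancel₀ _ hGpos.ne']
  linarith

lemma modLommel_eq (μ ν : ℝ) {x : ℝ} (hx : 0 < x) :
    modLommel μ ν x = (x / 2) ^ (μ + 1) *
      ∑' k : ℕ, lommelCoeff ((μ - ν + 3) / 2) ((μ + ν + 3) / 2) k * ((x / 2) ^ 2) ^ k := by
  have hy : 0 < x / 2 := by positivity
  rw [modLommel, ← tsum_mul_left]
  refine tsum_congr fun k => ?_
  rw [show μ + 2 * (k : ℝ) + 1 = (μ + 1) + ((2 * k : ℕ) : ℝ) by push_cast; ring,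
    rpow_add hy, rpow_natCast, pow_mul, lommelCoeff]
  ring

lemma one_div_Gamma_sub_one {A : ℝ} (hA : 0 < A) :
    1 / Gamma (A - 1) = (A - 1) / Gamma A := by
  rcases eq_or_ne A 1 with rfl | h
  · simp
  · have h' : A - 1 ≠ 0 := sub_ne_zero.mpr h
    have hG := (Gamma_pos_of_pos hA).ne'
    have := Gamma_add_one h'
    rw [sub_add_cancel] at this
    rw [this] at hG ⊢
    have := right_ne_zero_of_mul hG
    field_simp

theorem stmt_11 (μ ν : ℝ) (hμ : μ > -3) (hν : |ν| < μ + 3) :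
    ∀ x : ℝ, 0 < x →
      |x * deriv (modLommel μ ν) x / modLommel μ ν x| <
        Real.sqrt (x ^ 2 + ν ^ 2 + 2 * (μ + ν + 1) * bLommel μ ν x) := by
  intro x hx
  obtain ⟨hν₁, hν₂⟩ := abs_lt.mp hν
  set A := (μ - ν + 3) / 2 with hAdef
  set B := (μ + ν + 3) / 2 with hBdef
  have hA : 0 < A := by linarith
  have hB : 0 < B := by linarith
  have hy : 0 < x / 2 := by positivity
  have hz : 0 < (x / 2) ^ 2 := by positivity
  have hsum := summable_lommelCoeff_mul_pow hA hB hz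
  have hder := hasDerivAt_tsum_lommelCoeff hA hB hz
  have key := sq_mean_lt_second_moment hA hB hz hsum.hasSum
    (summable_lommelCoeff_deriv hA hB hz).hasSum
  have hGpos : 0 < ∑' k : ℕ, lommelCoeff A B k * ((x / 2) ^ 2) ^ k :=
    hsum.tsum_pos (fun k => (mul_pos (lommelCoeff_pos hA hB k) (by positivity)).le) 0
      (mul_pos (lommelCoeff_pos hA hB 0) (by positivity))
  have hval := modLommel_eq μ ν hx
  rw [← hAdef, ← hBdef] at hval
  have hhalf : HasDerivAt (fun t : ℝ => t / 2) (1 / 2) x := (hasDerivAt_id x).div_const 2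
  have hderiv := (hhalf.rpow_const (p := μ + 1) (Or.inl hy.ne')).mul
    (hder.comp x (hhalf.pow 2))
  have heq : deriv (modLommel μ ν) x = _ := (hderiv.congr_of_eventuallyEq (by
    filter_upwards [lt_mem_nhds hx] with t ht
    exact modLommel_eq μ ν ht)).deriv
  set G := ∑' k : ℕ, lommelCoeff A B k * ((x / 2) ^ 2) ^ k
  set D := ∑' k : ℕ, lommelCoeff A B k * (k * ((x / 2) ^ 2) ^ (k - 1))
  have hpow : 0 < (x / 2) ^ μ := rpow_pos_of_pos hy μ
  have hlog : x * deriv (modLommel μ ν) x / modLommel μ ν x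
      = A + B - 2 + 2 * (x / 2) ^ 2 * D / G := by
    rw [heq, hval]
    simp only [Function.comp, Pi.pow_apply]
    change x * (_ + _ * (D * _)) / _ = _
    change x * (1 / 2 * (μ + 1) * (x / 2) ^ (μ + 1 - 1) * G + _) / _ = _
    rw [add_sub_cancel_right, rpow_add_one hy.ne',
      show A + B - 2 = μ + 1 by rw [hAdef, hBdef]; ring]
    field_simp
    simp
    ring
  have hb : 2 * (μ + ν + 1) * bLommel μ ν x
      = 4 * (A - 1) * (B - 1) * lommelCoeff A B 0 / G := by
    have h : aLommel μ ν x = (x / 2) ^ μ * ((A - 1) * lommelCoeff A B 0) := by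
      rw [aLommel, show (μ - ν + 1) / 2 = A - 1 by rw [hAdef]; ring, ← hBdef, lommelCoeff,
        div_eq_mul_one_div, ← one_div_mul_one_div, one_div_Gamma_sub_one hA]
      simp only [Nat.cast_zero, zero_add]
      ring
    rw [bLommel, hval, h, rpow_add_one hy.ne', show μ + ν + 1 = 2 * (B - 1) by rw [hBdef]; ring]
    field_simp
    ring
  rw [hlog, hb]
  refine lt_sqrt_of_sq_lt ((sq_abs _).trans_lt (key.trans_eq ?_))
  rw [show A - B = -ν by rw [hAdef, hBdef]; ring]
  ring
end

section
/- Let μ, ν be real with μ > −3 and |ν| < μ+3. Then for all 0 < x < y, t̃_{μ,ν}(x)/t̃_{μ,ν}(y) < (x/y)^{μ+1}. -/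
open Real

/-- The `k`-th term of the series defining `modLommel μ ν x`. -/
noncomputable def modLommelTerm (μ ν x : ℝ) (k : ℕ) : ℝ :=
  (x / 2) ^ (μ + 2 * (k : ℝ) + 1) /
    (Gamma ((k : ℝ) + (μ - ν + 3) / 2) * Gamma ((k : ℝ) + (μ + ν + 3) / 2))

theorem modLommelTerm_pos {μ ν x : ℝ} (hν : |ν| < μ + 3) (hx : 0 < x) (k : ℕ) :
    0 < modLommelTerm μ ν x k := by
  obtain ⟨h₁, h₂⟩ := abs_lt.mp hν
  have hk : (0 : ℝ) ≤ k := k.cast_nonneg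
  exact div_pos (rpow_pos_of_pos (by positivity) _)
    (mul_pos (Gamma_pos_of_pos (by linarith)) (Gamma_pos_of_pos (by linarith)))

theorem modLommelTerm_succ {μ ν x : ℝ} (hν : |ν| < μ + 3) (hx : 0 < x) (k : ℕ) :
    modLommelTerm μ ν x (k + 1) = modLommelTerm μ ν x k *
      ((x / 2) ^ 2 * (((k : ℝ) + (μ - ν + 3) / 2)⁻¹ * ((k : ℝ) + (μ + ν + 3) / 2)⁻¹)) := by
  obtain ⟨h₁, h₂⟩ := abs_lt.mp hν
  have hk : (0 : ℝ) ≤ k := k.cast_nonneg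
  have ha : 0 < (k : ℝ) + (μ - ν + 3) / 2 := by linarith
  have hb : 0 < (k : ℝ) + (μ + ν + 3) / 2 := by linarith
  have hpow : (x / 2) ^ (μ + 2 * ((k + 1 : ℕ) : ℝ) + 1) =
      (x / 2) ^ (μ + 2 * (k : ℝ) + 1) * (x / 2) ^ 2 := by
    rw [← rpow_natCast (x / 2) 2, ← rpow_add (by positivity)]
    congr 1
    push_cast
    ring
  have hGa := (Gamma_pos_of_pos ha).ne'
  have hGb := (Gamma_pos_of_pos hb).ne'
  have ha' : ((k + 1 : ℕ) : ℝ) + (μ - ν + 3) / 2 = (k : ℝ) + (μ - ν + 3) / 2 + 1 := by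
    push_cast
    ring
  have hb' : ((k + 1 : ℕ) : ℝ) + (μ + ν + 3) / 2 = (k : ℝ) + (μ + ν + 3) / 2 + 1 := by
    push_cast
    ring
  rw [modLommelTerm, modLommelTerm, hpow, ha', hb', Gamma_add_one ha.ne', Gamma_add_one hb.ne']
  simp only [div_eq_mul_inv, mul_inv]
  ring

theorem summable_modLommelTerm {μ ν x : ℝ} (hν : |ν| < μ + 3) (hx : 0 < x) :
    Summable (modLommelTerm μ ν x) := by
  have hpos := modLommelTerm_pos hν hx
  have hinv (c : ℝ) : Filter.Tendsto (fun k : ℕ ↦ ((k : ℝ) + c)⁻¹) Filter.atTop (nhds 0) :=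
    (Filter.tendsto_atTop_add_const_right _ c tendsto_natCast_atTop_atTop).inv_tendsto_atTop
  refine summable_of_ratio_test_tendsto_lt_one zero_lt_one (.of_forall fun k ↦ (hpos k).ne') ?_
  have hlim := ((hinv ((μ - ν + 3) / 2)).mul (hinv ((μ + ν + 3) / 2))).const_mul ((x / 2) ^ 2)
  rw [mul_zero, mul_zero] at hlim
  refine hlim.congr fun k ↦ ?_
  rw [norm_of_nonneg (hpos _).le, norm_of_nonneg (hpos _).le, modLommelTerm_succ hν hx,
    mul_div_cancel_left₀ _ (hpos k).ne']

theorem modLommelTerm_eq_rpow_mul {μ ν x y : ℝ} (hx : 0 < x) (hy : 0 < y) (k : ℕ) :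
    modLommelTerm μ ν x k = (x / y) ^ (μ + 2 * (k : ℝ) + 1) * modLommelTerm μ ν y k := by
  have h : x / 2 = x / y * (y / 2) := by field_simp
  rw [modLommelTerm, h, mul_rpow (by positivity) (by positivity), mul_div_assoc, modLommelTerm]

theorem stmt_17 (μ ν : ℝ) (hμ : μ > -3) (hν : |ν| < μ + 3) :
    ∀ x y : ℝ, 0 < x → x < y →
      modLommel μ ν x / modLommel μ ν y < (x / y) ^ (μ + 1) := by
  intro x y hx hxy
  have hy := hx.trans hxy
  have hq : 0 < x / y := div_pos hx hy
  have hq1 : x / y < 1 := (div_lt_one hy).mpr hxy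
  have hsum := summable_modLommelTerm hν hy
  have hypos := modLommelTerm_pos hν hy
  change (∑' k, modLommelTerm μ ν x k) / (∑' k, modLommelTerm μ ν y k) < _
  rw [div_lt_iff₀ (hsum.tsum_pos (fun k ↦ (hypos k).le) 0 (hypos 0)), ← tsum_mul_left]
  refine Summable.tsum_lt_tsum (i := 1) (fun k ↦ ?_) ?_ (summable_modLommelTerm hν hx)
    (hsum.mul_left _)
  · rw [modLommelTerm_eq_rpow_mul hx hy]
    have hk : (0 : ℝ) ≤ k := k.cast_nonneg
    exact mul_le_mul_of_nonneg_right
      (rpow_le_rpow_of_exponent_ge hq hq1.le (by linarith)) (hypos k).le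
  · rw [modLommelTerm_eq_rpow_mul hx hy]
    exact mul_lt_mul_of_pos_right
      (rpow_lt_rpow_of_exponent_gt hq hq1 (by push_cast; linarith)) (hypos 1)
end
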